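/- arXiv:2604.15405 — 2 statements merged into one kernel-verified Lean document; each statement's English description precedes it below -/
import Mathlib

section
/- Let k ≥ 1, let a_1,...,a_k ∈ Z/4Z, let B ∈ F_2^{k×k} be symmetric with zero diagonal, and define φ : F_2^k → Z/4Z by φ(y) = Σ_t a_t y_t + 2·Σ_{i<j} B_{ij} y_i y_j (lifting bits to {0,1} ⊂ ℤ, reducing mod 4). Let g(m) = m XOR ⌊m/2⌋, identified with an element of F_2^k via binary expansion, and for m ≥ 1 let t(m) be the coordinate in which g(m) and g(m−1) differ. Define q : {0,...,2^k−1} → Z/4Z recursively by q(0) = 0 and q(m) = q(m−1) + (1 − 2·g(m−1)_{t(m)})·a_{t(m)} + 2·(B·g(m−1))_{t(m)}. Then q(m) = φ(g(m)) for every m ∈ {0,...,2^k−1}. -/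
/-- Doubling, as an additive map from `ZMod 2` to `ZMod 4`. -/
def zmodTwoDouble : ZMod 2 →+ ZMod 4 where
  toFun x := 2 * (x.val : ZMod 4)
  map_zero' := by decide
  map_add' := by decide

theorem zmodTwoDouble_apply (x : ZMod 2) : zmodTwoDouble x = 2 * (x.val : ZMod 4) := rfl

theorem zmodTwoDouble_mul_mul (b x y : ZMod 2) :
    zmodTwoDouble (b * x * y) = 2 * ((b.val * x.val * y.val : ℕ) : ZMod 4) := by
  revert b x y
  decide

theorem ZMod.natCast_val_add_one_of_two (x : ZMod 2) :
    (((x + 1).val : ℕ) : ZMod 4) = (x.val : ZMod 4) + (1 - 2 * (x.val : ZMod 4)) := by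
  revert x
  decide

theorem ZMod.eq_add_one_of_ne_of_two {x y : ZMod 2} (h : x ≠ y) : x = y + 1 := by
  revert x y
  decide

/-- Flipping coordinate `s` changes the quadratic form of the strict upper triangle of a symmetric
matrix with zero diagonal by the `s`-th entry of the matrix-vector product. -/
theorem sum_lt_mul_mul_add_single {ι R : Type*} [Fintype ι] [LinearOrder ι] [CommRing R]
    (B : Matrix ι ι R) (hBsymm : ∀ i j, B i j = B j i) (hBdiag : ∀ i, B i i = 0)
    (y : ι → R) (s : ι) :
    (∑ i, ∑ j, if i < j then
        B i j * (y i + if i = s then 1 else 0) * (y j + if j = s then 1 else 0) else 0)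
      = (∑ i, ∑ j, if i < j then B i j * y i * y j else 0) + B.mulVec y s := by
  have expand : ∀ i j, (if i < j then
        B i j * (y i + if i = s then 1 else 0) * (y j + if j = s then 1 else 0) else 0)
      = (if i < j then B i j * y i * y j else 0)
        + (if i = s then (if s < j then B s j * y j else 0) else 0)
        + (if j = s then (if i < s then B s i * y i else 0) else 0) := by
    intro i j
    by_cases hi : i = s <;> by_cases hj : j = s
    · subst hi hj; simp
    · subst hi; simp only [hj]; split_ifs <;> simp_all; ring
    · subst hj; simp only [hi, hBsymm i j]; split_ifs <;> simp_all; ring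
    · simp [hi, hj]
  have row : ∀ j, (if s < j then B s j * y j else 0) + (if j < s then B s j * y j else 0)
      = B s j * y j := by
    intro j
    rcases lt_trichotomy s j with h | h | h
    · simp [h, h.not_gt]
    · subst h; simp [hBdiag]
    · simp [h, h.not_gt]
  simp only [expand, Finset.sum_add_distrib, Finset.sum_ite_eq', Finset.mem_univ, if_true]
  rw [Finset.sum_comm (f := fun i j => if i = s then (if s < j then B s j * y j else 0) else 0)]
  simp only [Finset.sum_ite_eq', Finset.mem_univ, if_true]
  rw [add_assoc, ← Finset.sum_add_distrib]
  simp only [row, Matrix.mulVec, dotProduct]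

/-- Correctness of the recursive phase-exponent update along the Gray walk:
with `q(0) = 0` and
`q(m) = q(m−1) + (1 − 2 g(m−1)_{t(m)}) a_{t(m)} + 2 (B·g(m−1))_{t(m)}`,
one has `q(m) = φ(g(m))` for all `m < 2^k`. -/
theorem gray_walk_phase_correct (k : ℕ) (hk : 1 ≤ k) (a : Fin k → ZMod 4)
    (B : Matrix (Fin k) (Fin k) (ZMod 2))
    (hBsymm : ∀ i j : Fin k, B i j = B j i) (hBdiag : ∀ i : Fin k, B i i = 0)
    (φ : (Fin k → ZMod 2) → ZMod 4)
    (hφ : ∀ y : Fin k → ZMod 2,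
      φ y = ∑ t : Fin k, a t * ((y t).val : ZMod 4)
        + 2 * ∑ i : Fin k, ∑ j : Fin k,
            if i < j then (((B i j).val * (y i).val * (y j).val : ℕ) : ZMod 4) else 0)
    (gv : ℕ → Fin k → ZMod 2)
    (hg : ∀ (m : ℕ) (i : Fin k),
      gv m i = if Nat.testBit (m ^^^ m / 2) i.val then 1 else 0)
    (t : ℕ → Fin k)
    (ht : ∀ m : ℕ, 1 ≤ m → m < 2 ^ k → ∀ i : Fin k, gv m i ≠ gv (m - 1) i ↔ i = t m)
    (q : ℕ → ZMod 4)
    (hq0 : q 0 = 0)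
    (hq : ∀ m : ℕ, 1 ≤ m → m < 2 ^ k →
      q m = q (m - 1) + (1 - 2 * ((gv (m - 1) (t m)).val : ZMod 4)) * a (t m)
        + 2 * (((B.mulVec (gv (m - 1))) (t m)).val : ZMod 4)) :
    ∀ m : ℕ, m < 2 ^ k → q m = φ (gv m) := by
  have double_form : ∀ y : Fin k → ZMod 2,
      2 * (∑ i : Fin k, ∑ j : Fin k,
            if i < j then (((B i j).val * (y i).val * (y j).val : ℕ) : ZMod 4) else 0)
        = zmodTwoDouble (∑ i, ∑ j, if i < j then B i j * y i * y j else 0) := by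
    intro y
    simp only [map_sum, apply_ite zmodTwoDouble, map_zero, zmodTwoDouble_mul_mul, Finset.mul_sum,
      mul_ite, mul_zero]
  intro m
  induction m with
  | zero =>
    intro _
    have gv_zero : gv 0 = 0 := by
      funext i
      simp [hg]
    simp [hq0, hφ, gv_zero]
  | succ n ih =>
    intro hn
    have step := hq (n + 1) (Nat.le_add_left 1 n) hn
    have flip := ht (n + 1) (Nat.le_add_left 1 n) hn
    rw [Nat.add_sub_cancel] at step flip
    generalize t (n + 1) = s at step flip
    have gv_succ : gv (n + 1) = fun i => gv n i + if i = s then 1 else 0 := by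
      funext i
      by_cases hi : i = s
      · simpa [hi] using ZMod.eq_add_one_of_ne_of_two ((flip s).2 rfl)
      · simpa [hi] using not_not.1 (mt (flip i).1 hi)
    have linear : ∀ i, a i * (((gv n i + if i = s then 1 else 0).val : ℕ) : ZMod 4)
        = a i * ((gv n i).val : ZMod 4)
          + if i = s then (1 - 2 * ((gv n s).val : ZMod 4)) * a s else 0 := by
      intro i
      by_cases hi : i = s
      · subst hi
        simp only [if_true, ZMod.natCast_val_add_one_of_two]
        ring
      · simp [hi]
    rw [step, ih (Nat.lt_of_succ_lt hn), hφ, hφ, gv_succ, double_form, double_form,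
      sum_lt_mul_mul_add_single B hBsymm hBdiag, map_add,
      zmodTwoDouble_apply (B.mulVec (gv n) s)]
    simp only [linear, Finset.sum_add_distrib, Finset.sum_ite_eq', Finset.mem_univ, if_true]
    ring
end

section
/- Fix n ≥ 1 and a quadratic-form description: h ∈ F_2^n, linearly independent v_1,...,v_k ∈ F_2^n, d ∈ F_2^k, upper-triangular J ∈ F_2^{k×k}, and a nonzero complex scalar γ. Define ψ : F_2^n → ℂ by ψ(h ⊕ Σ_t y_t v_t) = γ · i^{d^⊤ y} · (−1)^{y^⊤ J y} for every y ∈ F_2^k (exponents computed from bit lifts to {0,1} ⊂ ℤ) and ψ(x) = 0 for x outside the affine subspace h + span{v_1,...,v_k}. Let a_t = d_t + 2·J_{tt} ∈ Z/4Z, let B be the symmetrization of J with zero diagonal, let g(m) = m XOR ⌊m/2⌋ be the Gray code with flipped coordinate t(m), and define recursively x(0) = h, q(0) = 0, x(m) = x(m−1) ⊕ v_{t(m)}, q(m) = q(m−1) + (1 − 2·g(m−1)_{t(m)})·a_{t(m)} + 2·(B·g(m−1))_{t(m)} in Z/4Z. Then ψ(x(m)) = γ · i^{q(m)} for every m ∈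 {0,...,2^k−1}, and the map m ↦ x(m) is a bijection from {0,...,2^k−1} onto the support {x : ψ(x) ≠ 0} of ψ. -/
/-- The Gray code `m ↦ m ^^^ m / 2` is injective on `k`-bit numbers, tested on the low `k` bits. -/
theorem eq_of_testBit_gray_eq {k m m' : ℕ} (hm : m < 2 ^ k) (hm' : m' < 2 ^ k)
    (hbit : ∀ i < k, (m ^^^ m / 2).testBit i = (m' ^^^ m' / 2).testBit i) : m = m' := by
  have high : ∀ i, k ≤ i → m.testBit i = m'.testBit i := fun i hi => by
    rw [Nat.testBit_lt_two_pow (hm.trans_le (Nat.pow_le_pow_right two_pos hi)),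
      Nat.testBit_lt_two_pow (hm'.trans_le (Nat.pow_le_pow_right two_pos hi))]
  have down : ∀ j i, k ≤ i + j → m.testBit i = m'.testBit i := by
    intro j
    induction j with
    | zero => exact high
    | succ j ih =>
      intro i hi
      by_cases hik : i < k
      · have hnext := ih (i + 1) (by omega)
        have hi' := hbit i hik
        rw [Nat.testBit_xor, Nat.testBit_xor, Nat.testBit_div_two, Nat.testBit_div_two,
          hnext] at hi'
        exact Bool.xor_left_inj.mp hi'
      · exact high i (not_lt.mp hik)
  exact Nat.eq_of_testBit_eq fun i => down k i (by omega)

/-- Doubling the bit lift is additive modulo 4. -/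
theorem two_mul_val_sum {ι : Type*} (s : Finset ι) (f : ι → ZMod 2) :
    2 * (((∑ j ∈ s, f j).val : ℕ) : ZMod 4) = ∑ j ∈ s, 2 * ((f j).val : ZMod 4) :=
  map_sum (AddMonoidHom.mk' (fun b : ZMod 2 => 2 * (b.val : ZMod 4)) (by decide)) f s

/-- A phase exponent `c + 2 e` may be reduced modulo 4. -/
theorem I_pow_mul_neg_one_pow (c e : ℕ) :
    Complex.I ^ c * (-1 : ℂ) ^ e = Complex.I ^ ((c : ZMod 4) + 2 * (e : ZMod 4)).val := by
  have hcast : (c : ZMod 4) + 2 * (e : ZMod 4) = ((c + 2 * e : ℕ) : ZMod 4) := by push_cast; rfl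
  rw [hcast, ZMod.val_natCast, ← Complex.I_sq, ← pow_mul, ← pow_add]
  exact pow_eq_pow_mod _ Complex.I_pow_four

/-- The quadratic phase exponent `dᵀ y + 2 yᵀ J y` modulo 4, computed on bit lifts. -/
def phaseExponent {k : ℕ} (d : Fin k → ZMod 2) (J : Matrix (Fin k) (Fin k) (ZMod 2))
    (y : Fin k → ZMod 2) : ZMod 4 :=
  ((∑ t : Fin k, (d t).val * (y t).val : ℕ) : ZMod 4) +
    2 * ((∑ i : Fin k, ∑ j : Fin k, (y i).val * (J i j).val * (y j).val : ℕ) : ZMod 4)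

/-- Expansion of a quadratic form under a change of a single coordinate. -/
theorem sum_sum_add_single {R : Type*} [CommRing R] {k : ℕ} (M : Fin k → Fin k → R)
    (Y : Fin k → R) (s : Fin k) (δ : R) :
    ∑ i, ∑ j, (Y i + if i = s then δ else 0) * M i j * (Y j + if j = s then δ else 0) =
      (∑ i, ∑ j, Y i * M i j * Y j) + δ * (∑ j, (M s j + M j s) * Y j) + δ ^ 2 * M s s := by
  simp only [add_mul, mul_add, Finset.sum_add_distrib, ite_mul, zero_mul, mul_ite, mul_zero,
    Finset.sum_ite_eq', Finset.sum_ite_irrel, Finset.mem_univ, if_true, Finset.mul_sum,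
    Finset.sum_const_zero]
  have h₁ : ∀ j, Y j * M j s * δ = δ * (M j s * Y j) := fun j => by ring
  have h₂ : ∀ j, δ * M s j * Y j = δ * (M s j * Y j) := fun j => by ring
  simp only [h₁, h₂]
  ring

/-- The increment of the phase exponent when one coordinate is flipped. -/
theorem phaseExponent_add_single {k : ℕ} (d : Fin k → ZMod 2)
    (J B : Matrix (Fin k) (Fin k) (ZMod 2)) (hJ : ∀ i j : Fin k, j < i → J i j = 0)
    (hB : ∀ i j : Fin k, B i j = if i < j then J i j else if j < i then J j i else 0)
    (y : Fin k → ZMod 2) (s : Fin k) :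
    phaseExponent d J (y + Pi.single s 1) = phaseExponent d J y +
      (1 - 2 * ((y s).val : ZMod 4)) * (((d s).val : ZMod 4) + 2 * ((J s s).val : ZMod 4)) +
      2 * (((B.mulVec y) s).val : ZMod 4) := by
  have hflip : ∀ i, (((y + Pi.single s 1 : Fin k → ZMod 2) i).val : ZMod 4) =
      ((y i).val : ZMod 4) + if i = s then 1 - 2 * ((y s).val : ZMod 4) else 0 := by
    intro i
    by_cases his : i = s
    · subst his
      rw [Pi.add_apply, Pi.single_eq_same, if_pos rfl]
      generalize y i = b
      revert b
      decide
    · simp [his]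
  have hcross : 2 * (((B.mulVec y) s).val : ZMod 4) =
      2 * ∑ j, (((J s j).val : ZMod 4) + ((J j s).val : ZMod 4)) * ((y j).val : ZMod 4) := by
    rw [Matrix.mulVec, dotProduct, two_mul_val_sum, Finset.mul_sum]
    refine Finset.sum_congr rfl fun j _ => ?_
    have key : ∀ b c : ZMod 2, 2 * ((b * c).val : ZMod 4) =
        2 * (((b.val : ZMod 4) + ((0 : ZMod 2).val : ZMod 4)) * (c.val : ZMod 4)) := by decide
    rcases lt_trichotomy s j with hlt | rfl | hlt
    · rw [hB, if_pos hlt, hJ j s hlt, key]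
    · rw [hB, if_neg (lt_irrefl _), if_neg (lt_irrefl _)]
      generalize J s s = b
      generalize y s = c
      revert b c
      decide
    · rw [hB, if_neg hlt.asymm, if_pos hlt, hJ s j hlt, key, add_comm]
  rw [hcross, phaseExponent, phaseExponent]
  push_cast
  simp only [hflip]
  rw [sum_sum_add_single]
  simp only [mul_add, Finset.sum_add_distrib, mul_ite, mul_zero, Finset.sum_ite_eq',
    Finset.mem_univ, if_true]
  have four : (4 : ZMod 4) = 0 := by decide
  generalize ((y s).val : ZMod 4) = b
  generalize ∑ j, (((J s j).val : ZMod 4) + ((J j s).val : ZMod 4)) * ((y j).val : ZMod 4) = S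
  linear_combination (-b * S + (b ^ 2 * 2 - b) * ((J s s).val : ZMod 4)) * four

/-- Correctness of the Gray-walk materialization of a stabilizer state from a
quadratic-form description: the recursively computed pairs `(x(m), q(m))`
satisfy `ψ(x(m)) = γ · i^{q(m)}` for all `m < 2^k`, and `m ↦ x(m)` is a
bijection from `{0,...,2^k−1}` onto the support of `ψ`. -/
theorem stabilizer_materialization_correct (n k : ℕ) (hn : 1 ≤ n)
    (h : Fin n → ZMod 2)
    (v : Fin k → Fin n → ZMod 2) (hv : LinearIndependent (ZMod 2) v)
    (d : Fin k → ZMod 2)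
    (J : Matrix (Fin k) (Fin k) (ZMod 2))
    (hJ : ∀ i j : Fin k, j < i → J i j = 0)
    (γ : ℂ) (hγ : γ ≠ 0)
    (ψ : (Fin n → ZMod 2) → ℂ)
    (hψ : ∀ y : Fin k → ZMod 2,
      ψ (h + ∑ t : Fin k, y t • v t)
        = γ * Complex.I ^ (∑ t : Fin k, (d t).val * (y t).val)
            * (-1 : ℂ) ^ (∑ i : Fin k, ∑ j : Fin k, (y i).val * (J i j).val * (y j).val))
    (hψ0 : ∀ z : Fin n → ZMod 2,
      (∀ w ∈ Submodule.span (ZMod 2) (Set.range v), z ≠ h + w) → ψ z = 0)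
    (a : Fin k → ZMod 4)
    (ha : ∀ t : Fin k, a t = ((d t).val : ZMod 4) + 2 * ((J t t).val : ZMod 4))
    (B : Matrix (Fin k) (Fin k) (ZMod 2))
    (hB : ∀ i j : Fin k, B i j = if i < j then J i j else if j < i then J j i else 0)
    (gv : ℕ → Fin k → ZMod 2)
    (hg : ∀ (m : ℕ) (i : Fin k),
      gv m i = if Nat.testBit (m ^^^ m / 2) i.val then 1 else 0)
    (t : ℕ → Fin k)
    (ht : ∀ m : ℕ, 1 ≤ m → m < 2 ^ k → ∀ i : Fin k, gv m i ≠ gv (m - 1) i ↔ i = t m)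
    (x : ℕ → Fin n → ZMod 2) (q : ℕ → ZMod 4)
    (hx0 : x 0 = h) (hq0 : q 0 = 0)
    (hx : ∀ m : ℕ, 1 ≤ m → m < 2 ^ k → x m = x (m - 1) + v (t m))
    (hq : ∀ m : ℕ, 1 ≤ m → m < 2 ^ k →
      q m = q (m - 1) + (1 - 2 * ((gv (m - 1) (t m)).val : ZMod 4)) * a (t m)
        + 2 * (((B.mulVec (gv (m - 1))) (t m)).val : ZMod 4)) :
    (∀ m : ℕ, m < 2 ^ k → ψ (x m) = γ * Complex.I ^ (q m).val) ∧
    Set.BijOn x (Set.Iio (2 ^ k)) {z | ψ z ≠ 0} := by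
  have hgv0 : gv 0 = 0 := by
    funext i
    simp [hg]
  have hstep : ∀ m, m + 1 < 2 ^ k → gv (m + 1) = gv m + Pi.single (t (m + 1)) 1 := by
    intro m hm
    funext i
    have hi := ht (m + 1) (by omega) hm i
    rw [Nat.add_sub_cancel] at hi
    have flip : ∀ b c : ZMod 2, b ≠ c → b = c + 1 := by decide
    by_cases his : i = t (m + 1)
    · subst his
      simpa using flip _ _ (hi.mpr rfl)
    · simpa [his] using hi
  have hxg : ∀ m, m < 2 ^ k → x m = h + ∑ i, gv m i • v i := by
    intro m
    induction m with
    | zero => intro _; simp [hx0, hgv0]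
    | succ m ih =>
      intro hm
      rw [hx (m + 1) (by omega) hm, Nat.add_sub_cancel, ih (by omega), hstep m hm]
      simp [add_smul, Finset.sum_add_distrib, Pi.single_apply, ite_smul, add_assoc]
  have hqg : ∀ m, m < 2 ^ k → q m = phaseExponent d J (gv m) := by
    intro m
    induction m with
    | zero => intro _; simp [hq0, hgv0, phaseExponent]
    | succ m ih =>
      intro hm
      rw [hq (m + 1) (by omega) hm, Nat.add_sub_cancel, ih (by omega), hstep m hm,
        phaseExponent_add_single d J B hJ hB, ha]
  have hval : ∀ m, m < 2 ^ k → ψ (x m) = γ * Complex.I ^ (q m).val := fun m hm => by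
    rw [hxg m hm, hψ, hqg m hm, mul_assoc, I_pow_mul_neg_one_pow, phaseExponent]
  have hgvinj : ∀ m < 2 ^ k, ∀ m' < 2 ^ k, gv m = gv m' → m = m' := by
    intro m hm m' hm' heq
    refine eq_of_testBit_gray_eq hm hm' fun i hi => ?_
    have hbit := congrFun heq ⟨i, hi⟩
    rw [hg, hg] at hbit
    revert hbit
    generalize (m ^^^ m / 2).testBit i = b
    generalize (m' ^^^ m' / 2).testBit i = c
    revert b c
    decide
  have hgvsurj : ∀ c : Fin k → ZMod 2, ∃ m < 2 ^ k, gv m = c := by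
    have hbij : Function.Bijective fun m : Fin (2 ^ k) => gv m :=
      (Fintype.bijective_iff_injective_and_card _).mpr
        ⟨fun m m' heq => Fin.ext (hgvinj m m.2 m' m'.2 heq), by simp⟩
    intro c
    obtain ⟨m, hm⟩ := hbij.2 c
    exact ⟨m, m.2, hm⟩
  refine ⟨hval, fun m hm => ?_, fun m hm m' hm' heq => ?_, fun z hz => ?_⟩
  · rw [Set.mem_ofPred_eq, hval m hm]
    exact mul_ne_zero hγ (pow_ne_zero _ Complex.I_ne_zero)
  · rw [hxg m hm, hxg m' hm', add_right_inj] at heq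
    exact hgvinj m hm m' hm' (Fintype.linearIndependent_iffₛ.mp hv _ _ heq |> funext)
  · have hz' : ∃ w ∈ Submodule.span (ZMod 2) (Set.range v), z = h + w := by
      by_contra! hcon
      exact hz (hψ0 z hcon)
    obtain ⟨w, hw, rfl⟩ := hz'
    obtain ⟨c, rfl⟩ := (Submodule.mem_span_range_iff_exists_fun (ZMod 2)).mp hw
    obtain ⟨m, hm, rfl⟩ := hgvsurj c
    exact ⟨m, hm, hxg m hm⟩
end
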